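/- arXiv:1510.04667 — 2 statements merged into one kernel-verified Lean document; each statement's English description precedes it below -/
import Mathlib

section
/- Let B be a translation invariant differentiation basis on ℝ² and let f ∈ L¹(ℝ²) with support contained in the open unit square (0,1)². Then the set R_B(f) = {γ ∈ Γ₂ : the upper derivative D̄_{B(γ)}(∫f, x) equals +∞ for almost every x ∈ (0,1)²} is of type G_δ in Γ₂ (i.e., it is a countable intersection of open subsets of the circle Γ₂). -/
open MeasureTheory Filter Set Topology

noncomputable section

/-- A differentiation basis on the plane (identified with `ℂ`): to each point `x` it assigns a
family of bounded measurable sets of positive measure containing `x`, admitting a sequence of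
sets whose diameters tend to `0`. -/
structure DiffBasis where
  sets : ℂ → Set (Set ℂ)
  bounded : ∀ x, ∀ R ∈ sets x, Bornology.IsBounded R
  measurable : ∀ x, ∀ R ∈ sets x, MeasurableSet R
  pos_measure : ∀ x, ∀ R ∈ sets x, 0 < volume R
  mem_self : ∀ x, ∀ R ∈ sets x, x ∈ R
  shrink : ∀ x, ∃ Rk : ℕ → Set ℂ, (∀ k, Rk k ∈ sets x) ∧
    Tendsto (fun k => Metric.diam (Rk k)) atTop (nhds 0)

/-- Translation invariance of a differentiation basis. -/
def DiffBasis.TI (B : DiffBasis) : Prop :=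
  ∀ x, B.sets x = (fun R => (fun y => x + y) '' R) '' B.sets 0

/-- The `γ`-rotated family of a set family: each `R ∈ S x` is rotated by `γ` around `x`. -/
def rotSets (S : ℂ → Set (Set ℂ)) (γ : Circle) : ℂ → Set (Set ℂ) :=
  fun x => (fun R => (fun y => x + (γ : ℂ) * (y - x)) '' R) '' S x

/-- The filter of "sets from the family with diameter tending to zero". -/
def basisFilter (F : Set (Set ℂ)) : Filter (Set ℂ) :=
  ⨅ r : {r : ℝ // 0 < r}, Filter.principal {R ∈ F | Metric.diam R < r.1}

/-- The average `(1/|R|) ∫_R f`. -/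
def avgI (f : ℂ → ℝ) (R : Set ℂ) : ℝ := (volume R).toReal⁻¹ * ∫ z in R, f z

/-- The upper derivative of `∫ f` with respect to the family `S` at `x`. -/
def upperD (S : ℂ → Set (Set ℂ)) (f : ℂ → ℝ) (x : ℂ) : EReal :=
  Filter.limsup (fun R => ((avgI f R : ℝ) : EReal)) (basisFilter (S x))

/-- The lower derivative of `∫ f` with respect to the family `S` at `x`. -/
def lowerD (S : ℂ → Set (Set ℂ)) (f : ℂ → ℝ) (x : ℂ) : EReal :=
  Filter.liminf (fun R => ((avgI f R : ℝ) : EReal)) (basisFilter (S x))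

/-- `∫ f` is differentiable with respect to the family `S`. -/
def Differentiates (S : ℂ → Set (Set ℂ)) (f : ℂ → ℝ) : Prop :=
  ∀ᵐ x : ℂ, upperD S f x = ((f x : ℝ) : EReal) ∧ lowerD S f x = ((f x : ℝ) : EReal)

/-- The open unit square `(0,1)²`. -/
def unitSquare : Set ℂ := {z | z.re ∈ Set.Ioo (0:ℝ) 1 ∧ z.im ∈ Set.Ioo (0:ℝ) 1}

/-- the rigid motion `y ↦ x + γ y` -/
def rigid (γ : Circle) (x : ℂ) : ℂ ≃ᵢ ℂ :=
  (rotation γ).toIsometryEquiv.trans (IsometryEquiv.addLeft x)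

lemma rigid_apply (γ : Circle) (x y : ℂ) : rigid γ x y = x + (γ : ℂ) * y := by
  simp [rigid, rotation_apply]

lemma rigid_mp (γ : Circle) (x : ℂ) : MeasurePreserving (rigid γ x) volume volume := by
  have h := (measurePreserving_add_left (volume : Measure ℂ) x).comp
    (rotation γ).measurePreserving
  exact h

lemma rigid_emb (γ : Circle) (x : ℂ) : MeasurableEmbedding (rigid γ x) :=
  (rigid γ x).toHomeomorph.measurableEmbedding

lemma rot_eq (B : DiffBasis) (hB : B.TI) (γ : Circle) (x : ℂ) :
    rotSets B.sets γ x = (fun R => rigid γ x '' R) '' B.sets 0 := by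
  unfold rotSets
  rw [hB x, Set.image_image]
  congr 1
  funext R
  rw [Set.image_image]
  congr 1
  funext y
  rw [rigid_apply]
  simp

lemma avg_rigid (f : ℂ → ℝ) (γ : Circle) (x : ℂ) (R : Set ℂ) :
    avgI f (rigid γ x '' R) = (volume R).toReal⁻¹ * ∫ y in R, f (rigid γ x y) := by
  unfold avgI
  rw [(rigid_mp γ x).setIntegral_image_emb (rigid_emb γ x)]
  congr 3
  have := (rigid_mp γ x).measure_preimage_emb (rigid_emb γ x) (rigid γ x '' R)
  rw [← this, Set.preimage_image_eq _ (rigid γ x).injective]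

lemma cont_int (f : ℂ → ℝ) (hf : Integrable f) (R : Set ℂ) (hR : Bornology.IsBounded R) :
    Continuous (fun p : Circle × ℂ => ∫ y in R, f (rigid p.1 p.2 y)) := by
  rw [← continuousOn_univ]
  apply continuousOn_of_uniform_approx_of_continuousOn
  intro u hu
  obtain ⟨ε, hε, hεu⟩ := Metric.mem_uniformity_dist.1 hu
  obtain ⟨g, hgs, hg, hgc, hgi⟩ := hf.exists_hasCompactSupport_integral_sub_le (half_pos hε)
  refine ⟨fun p => ∫ y in R, g (rigid p.1 p.2 y), ?_, ?_⟩
  · rw [continuousOn_univ]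
    obtain ⟨C, hC⟩ := hgc.bounded_above_of_compact_support hgs
    have hb : IsFiniteMeasure (volume.restrict R) :=
      ⟨by rw [Measure.restrict_apply_univ]; exact hR.measure_lt_top⟩
    apply continuous_of_dominated (bound := fun _ => C)
    · intro p
      exact (hgc.comp (rigid p.1 p.2).continuous).aestronglyMeasurable
    · intro p
      exact Eventually.of_forall fun y => hC _
    · exact integrable_const _
    · refine Eventually.of_forall fun y => ?_
      simp only [rigid_apply]
      fun_prop
  · intro p _
    apply hεu
    have hfi : Integrable (fun y => f (rigid p.1 p.2 y)) :=
      (rigid_mp p.1 p.2).integrable_comp_emb (rigid_emb p.1 p.2) |>.2 hf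
    have hgi' : Integrable (fun y => g (rigid p.1 p.2 y)) :=
      (rigid_mp p.1 p.2).integrable_comp_emb (rigid_emb p.1 p.2) |>.2 hgi
    rw [Real.dist_eq, ← integral_sub hfi.integrableOn hgi'.integrableOn]
    calc |∫ y in R, (f (rigid p.1 p.2 y) - g (rigid p.1 p.2 y))|
        ≤ ∫ y in R, ‖f (rigid p.1 p.2 y) - g (rigid p.1 p.2 y)‖ :=
          by rw [← Real.norm_eq_abs]; exact norm_integral_le_integral_norm _
      _ ≤ ∫ y, ‖f (rigid p.1 p.2 y) - g (rigid p.1 p.2 y)‖ :=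
          setIntegral_le_integral (hfi.sub hgi').norm (Eventually.of_forall fun y => norm_nonneg _)
      _ = ∫ y, ‖f y - g y‖ :=
          (rigid_mp p.1 p.2).integral_comp (rigid_emb p.1 p.2) (fun y => ‖f y - g y‖)
      _ ≤ ε / 2 := hg
      _ < ε := half_lt_self hε

/-- the open set of pairs -/
def Wset (B : DiffBasis) (f : ℂ → ℝ) (n : ℕ) : Set (Circle × ℂ) :=
  {p | ∃ R ∈ B.sets 0, Metric.diam R < 1 / ((n : ℝ) + 1) ∧
    (n : ℝ) < (volume R).toReal⁻¹ * ∫ y in R, f (rigid p.1 p.2 y)}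

lemma Wset_open (B : DiffBasis) (f : ℂ → ℝ) (hf : Integrable f) (n : ℕ) :
    IsOpen (Wset B f n) := by
  have : Wset B f n = ⋃ R ∈ {R ∈ B.sets 0 | Metric.diam R < 1 / ((n : ℝ) + 1)},
      {p : Circle × ℂ | (n : ℝ) < (volume R).toReal⁻¹ * ∫ y in R, f (rigid p.1 p.2 y)} := by
    ext p
    simp [Wset, and_assoc]
  rw [this]
  refine isOpen_biUnion fun R hR => ?_
  exact isOpen_lt continuous_const (continuous_const.mul (cont_int f hf R (B.bounded 0 R hR.1)))

lemma upperD_top_iff (B : DiffBasis) (hB : B.TI) (f : ℂ → ℝ) (γ : Circle) (x : ℂ) :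
    upperD (rotSets B.sets γ) f x = ⊤ ↔ ∀ n, (γ, x) ∈ Wset B f n := by
  have hbasis : (basisFilter (rotSets B.sets γ x)).HasBasis (fun _ : {r : ℝ // 0 < r} => True)
      (fun r => {R ∈ rotSets B.sets γ x | Metric.diam R < r.1}) := by
    unfold basisFilter
    haveI : Nonempty {r : ℝ // 0 < r} := ⟨⟨1, one_pos⟩⟩
    apply hasBasis_iInf_principal
    intro a b
    refine ⟨⟨min a.1 b.1, lt_min a.2 b.2⟩, ?_, ?_⟩
    · intro R hR
      exact ⟨hR.1, hR.2.trans_le (min_le_left _ _)⟩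
    · intro R hR
      exact ⟨hR.1, hR.2.trans_le (min_le_right _ _)⟩
  unfold upperD
  rw [hbasis.limsup_eq_iInf_iSup]
  simp only [iInf_eq_top, true_imp_iff, iSup_eq_top]
  have key : ∀ R, Metric.diam (rigid γ x '' R) = Metric.diam R := fun R =>
    (rigid γ x).isometry.diam_image R
  constructor
  · intro h n
    have h1 := h ⟨1 / ((n : ℝ) + 1), by positivity⟩ (((n : ℝ) : EReal)) (EReal.coe_lt_top _)
    obtain ⟨S, hS⟩ := h1
    rw [lt_iSup_iff] at hS
    obtain ⟨⟨hS1, hS2⟩, hS3⟩ := hS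
    rw [rot_eq B hB] at hS1
    obtain ⟨R, hR, rfl⟩ := hS1
    simp only [key] at hS2
    refine ⟨R, hR, hS2, ?_⟩
    have := EReal.coe_lt_coe_iff.1 hS3
    rwa [avg_rigid] at this
  · intro h r b hb
    obtain ⟨n1, hn1⟩ := exists_nat_one_div_lt r.2
    obtain ⟨c, hbc, -⟩ := EReal.lt_iff_exists_real_btwn.1 hb
    obtain ⟨n2, hn2⟩ := exists_nat_gt c
    obtain ⟨R, hR, hd, ha⟩ := h (max n1 n2)
    refine ⟨rigid γ x '' R, ?_⟩
    rw [lt_iSup_iff]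
    refine ⟨⟨?_, ?_⟩, ?_⟩
    · rw [rot_eq B hB]
      exact ⟨R, hR, rfl⟩
    · rw [key]
      refine hd.trans (lt_of_le_of_lt ?_ hn1)
      apply one_div_le_one_div_of_le (by positivity)
      have : (n1 : ℝ) ≤ ((max n1 n2 : ℕ) : ℝ) := by exact_mod_cast le_max_left _ _
      linarith
    · refine hbc.trans ?_
      rw [EReal.coe_lt_coe_iff, avg_rigid]
      have : (n2 : ℝ) ≤ ((max n1 n2 : ℕ) : ℝ) := by exact_mod_cast le_max_right _ _
      dsimp only at ha
      linarith

lemma isOpen_unitSquare : IsOpen unitSquare :=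
  (isOpen_Ioo.preimage Complex.continuous_re).inter (isOpen_Ioo.preimage Complex.continuous_im)

lemma unitSquare_finite : volume unitSquare < ⊤ := by
  have : unitSquare ⊆ Metric.closedBall 0 2 := by
    intro z hz
    rw [mem_closedBall_zero_iff]
    have h := Complex.norm_le_abs_re_add_abs_im z
    obtain ⟨⟨h1, h2⟩, ⟨h3, h4⟩⟩ := hz
    rw [abs_of_pos h1, abs_of_pos h3] at h
    linarith
  exact (Metric.isBounded_closedBall.subset this).measure_lt_top

lemma slice_open (W : Set (Circle × ℂ)) (hW : IsOpen W) (ε : ENNReal) :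
    IsOpen {γ : Circle | volume (unitSquare \ {x | (γ, x) ∈ W}) < ε} := by
  rw [isOpen_iff_mem_nhds]
  intro γ hγ
  have hWγ : IsOpen {x | (γ, x) ∈ W} := hW.preimage (by fun_prop)
  set Q := unitSquare
  set U : Set ℂ := Q ∩ {x | (γ, x) ∈ W} with hU
  have hUo : IsOpen U := isOpen_unitSquare.inter hWγ
  have hUf : volume U ≠ ⊤ := (measure_mono inter_subset_left |>.trans_lt unitSquare_finite).ne
  simp only [mem_setOf_eq] at hγ
  obtain ⟨δ, hδ, hδε⟩ : ∃ δ : ENNReal, δ ≠ 0 ∧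
      volume (Q \ {x | (γ, x) ∈ W}) + δ < ε := by
    obtain ⟨c, hc1, hc2⟩ := exists_between hγ
    refine ⟨c - volume (Q \ {x | (γ, x) ∈ W}), (tsub_pos_of_lt hc1).ne', ?_⟩
    rwa [add_tsub_cancel_of_le hc1.le]
  obtain ⟨K, hKU, hKc, hK⟩ := hUo.measurableSet.exists_isCompact_diff_lt hUf hδ
  have htube : ∀ᶠ γ' in 𝓝 γ, ∀ x ∈ K, (γ', x) ∈ W :=
    hKc.eventually_forall_of_forall_eventually fun x hx =>
      hW.mem_nhds (hKU hx).2
  filter_upwards [htube] with γ' h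
  refine lt_of_le_of_lt ?_ hδε
  calc volume (Q \ {x | (γ', x) ∈ W})
      ≤ volume ((Q \ {x | (γ, x) ∈ W}) ∪ (U \ K)) := by
        apply measure_mono
        rintro x ⟨hx, hx'⟩
        by_cases hxw : (γ, x) ∈ W
        · exact Or.inr ⟨⟨hx, hxw⟩, fun hk => hx' (h x hk)⟩
        · exact Or.inl ⟨hx, hxw⟩
    _ ≤ _ := measure_union_le _ _
    _ ≤ _ := by gcongr

/-- for a translation invariant basis `B` on the plane and `f ∈ L¹` supported in the
open unit square, the set of rotations `γ` for which the upper derivative of `∫ f` with respect to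
`B(γ)` is `+∞` a.e. on `(0,1)²` is of type `G_δ`. -/
theorem Rset_of_TI_basis_is_Gdelta (B : DiffBasis) (hB : B.TI)
    (f : ℂ → ℝ) (hf : Integrable f) (hsupp : Function.support f ⊆ unitSquare) :
    IsGδ {γ : Circle | ∀ᵐ x : ℂ, x ∈ unitSquare → upperD (rotSets B.sets γ) f x = ⊤} := by
  have heq : {γ : Circle | ∀ᵐ x : ℂ, x ∈ unitSquare → upperD (rotSets B.sets γ) f x = ⊤} =
      ⋂ n : ℕ, ⋂ m : ℕ,
        {γ : Circle | volume (unitSquare \ {x | (γ, x) ∈ Wset B f n}) < ((m : ENNReal) + 1)⁻¹} := by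
    ext γ
    simp only [mem_setOf_eq, mem_iInter, upperD_top_iff B hB]
    have h1 : (∀ᵐ x : ℂ, x ∈ unitSquare → ∀ n, (γ, x) ∈ Wset B f n) ↔
        ∀ n, volume (unitSquare \ {x | (γ, x) ∈ Wset B f n}) = 0 := by
      have h2 : (∀ᵐ x : ℂ, x ∈ unitSquare → ∀ n, (γ, x) ∈ Wset B f n) ↔
          ∀ᵐ x : ℂ, ∀ n, x ∈ unitSquare → (γ, x) ∈ Wset B f n :=
        eventually_congr (Eventually.of_forall fun x => forall_comm)
      rw [h2, ae_all_iff]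
      refine forall_congr' fun n => ?_
      rw [ae_iff]
      have : {a | ¬(a ∈ unitSquare → (γ, a) ∈ Wset B f n)} =
        unitSquare \ {x | (γ, x) ∈ Wset B f n} := by
        ext x
        simp
      rw [this]
    rw [h1]
    refine forall_congr' fun n => ⟨fun h m => ?_, fun h => ?_⟩
    · rw [h]
      simp
    · by_contra hne
      obtain ⟨m, hm⟩ := ENNReal.exists_inv_nat_lt hne
      have h3 := (h m).trans_le (ENNReal.inv_le_inv.2 (le_self_add : (m : ENNReal) ≤ m + 1))
      exact lt_irrefl _ (h3.trans hm)
  rw [heq]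
  refine IsGδ.iInter fun n => IsGδ.iInter fun m => ?_
  exact (slice_open _ (Wset_open B f hf n) _).isGδ

end
end

section
/- Let B and H be differentiation bases on ℝ² with B(x) ⊆ H(x) for every x, and let (E_k)_{k∈N} be a nonempty finite or countable family of subsets of Γ₂ each of which is an R⁺_{B,H}-set. Then the union ⋃_{k∈N} E_k is a W⁺_{B,H}-set; that is, there exists a nonnegative f ∈ L¹(ℝ²) such that f ∉ F_{B(γ)} for every γ ∈ ⋃_{k∈N} E_k, and f ∈ F_{H(γ)} for every γ ∉ ⋃_{k∈N} E_k. -/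
open MeasureTheory Filter Set Topology

noncomputable section

/-- `E ⊆ Γ₂` is an `R⁺_{B,H}`-set (witnessed by a nonnegative `f ∈ L¹`). -/
def IsRPlusSet (B H : DiffBasis) (E : Set Circle) : Prop :=
  ∃ f : ℂ → ℝ, Integrable f ∧ (∀ z, 0 ≤ f z) ∧
    (∀ γ ∈ E, ∀ᵐ x : ℂ, upperD (rotSets B.sets γ) f x = ⊤) ∧
    (∀ γ ∉ E, Differentiates (rotSets H.sets γ) f)

theorem aux_isometry (x : ℂ) (γ : Circle) :
    Isometry (fun y : ℂ => x + (γ : ℂ) * (y - x)) := by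
  refine Isometry.of_dist_eq fun a b => ?_
  rw [dist_eq_norm, dist_eq_norm]
  have : x + (γ : ℂ) * (a - x) - (x + (γ : ℂ) * (b - x)) = γ * (a - b) := by ring
  rw [this, norm_mul, Circle.norm_coe, one_mul]

theorem aux_neBot (B : DiffBasis) (γ : Circle) (x : ℂ) :
    (basisFilter (rotSets B.sets γ x)).NeBot := by
  obtain ⟨Rk, hR, hd⟩ := B.shrink x
  have : Tendsto (fun k => (fun y : ℂ => x + (γ : ℂ) * (y - x)) '' Rk k) atTop
      (basisFilter (rotSets B.sets γ x)) := by
    unfold basisFilter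
    rw [tendsto_iInf]
    rintro ⟨r, hr⟩
    rw [tendsto_principal]
    filter_upwards [hd.eventually (gt_mem_nhds hr)] with k hk
    refine ⟨⟨Rk k, hR k, rfl⟩, ?_⟩
    rw [(aux_isometry x γ).diam_image]
    exact hk
  exact this.neBot

theorem aux_small (B : DiffBasis) (γ : Circle) (x : ℂ) (r : ℝ) (hr : 0 < r) :
    ∀ᶠ R in basisFilter (rotSets B.sets γ x), R ⊆ Metric.ball x r := by
  have h : {R ∈ rotSets B.sets γ x | Metric.diam R < r} ∈
      basisFilter (rotSets B.sets γ x) :=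
    Filter.mem_iInf_of_mem (⟨r, hr⟩ : {r : ℝ // 0 < r}) (Filter.mem_principal_self _)
  filter_upwards [h] with R hR
  obtain ⟨⟨T, hT, rfl⟩, hd⟩ := hR
  rw [(aux_isometry x γ).diam_image] at hd
  rintro _ ⟨y, hy, rfl⟩
  have h1 := (aux_isometry x γ).dist_eq y x
  simp only [sub_self, mul_zero, add_zero] at h1
  rw [Metric.mem_ball, h1]
  exact (Metric.dist_le_diam_of_mem (B.bounded x T hT) hy (B.mem_self x T hT)).trans_lt hd

theorem aux_tendsto (B : DiffBasis) (γ : Circle) (x : ℂ) (f : ℂ → ℝ) (a : ℝ) :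
    (upperD (rotSets B.sets γ) f x = (a : EReal) ∧ lowerD (rotSets B.sets γ) f x = (a : EReal)) ↔
      Tendsto (avgI f) (basisFilter (rotSets B.sets γ x)) (𝓝 a) := by
  haveI := aux_neBot B γ x
  rw [← EReal.tendsto_coe]
  constructor
  · rintro ⟨h1, h2⟩
    exact tendsto_of_liminf_eq_limsup h2 h1
  · intro h
    exact ⟨h.limsup_eq, h.liminf_eq⟩

def strip (n : ℤ) : Set ℂ := {z | ⌊z.re⌋ = n}

theorem aux_strip_meas (n : ℤ) : MeasurableSet (strip n) :=
  (Int.measurable_floor.comp Complex.measurable_re) (measurableSet_singleton n)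

theorem aux_ae_good : ∀ᵐ z : ℂ, ∀ n : ℤ, z.re ≠ n := by
  rw [ae_all_iff]
  intro n
  have h : ∀ᵐ p : ℝ × ℝ, p.1 ≠ (n : ℝ) :=
    Measure.quasiMeasurePreserving_fst.ae (p := fun t : ℝ => t ≠ (n : ℝ))
      (Measure.ae_ne volume (n : ℝ))
  exact Complex.volume_preserving_equiv_real_prod.quasiMeasurePreserving.ae h

theorem aux_ball (x : ℂ) (hx : ∀ n : ℤ, x.re ≠ n) :
    ∃ r : ℝ, 0 < r ∧ Metric.ball x r ⊆ strip ⌊x.re⌋ := by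
  have ho : IsOpen {z : ℂ | (⌊x.re⌋ : ℝ) < z.re ∧ z.re < ⌊x.re⌋ + 1} :=
    (isOpen_lt continuous_const Complex.continuous_re).inter
      (isOpen_lt Complex.continuous_re continuous_const)
  obtain ⟨r, hr, h⟩ := Metric.isOpen_iff.1 ho x
    ⟨lt_of_le_of_ne (Int.floor_le _) (hx _).symm, Int.lt_floor_add_one _⟩
  exact ⟨r, hr, fun z hz => Int.floor_eq_iff.2 ⟨(h hz).1.le, (h hz).2⟩⟩

theorem aux_local (B : DiffBasis) (γ : Circle) (x : ℂ) (hx : ∀ n : ℤ, x.re ≠ n)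
    (c : ℤ → ℝ) (hc : ∀ n, 0 < c n) (g : ℤ → ℂ → ℝ) (a : ℝ) :
    Tendsto (avgI (fun z => c ⌊z.re⌋ * g ⌊z.re⌋ z)) (basisFilter (rotSets B.sets γ x))
      (𝓝 (c ⌊x.re⌋ * a)) ↔
    Tendsto (avgI (g ⌊x.re⌋)) (basisFilter (rotSets B.sets γ x)) (𝓝 a) := by
  obtain ⟨r, hr, hb⟩ := aux_ball x hx
  have h : avgI (fun z => c ⌊z.re⌋ * g ⌊z.re⌋ z) =ᶠ[basisFilter (rotSets B.sets γ x)]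
      fun R => c ⌊x.re⌋ * avgI (g ⌊x.re⌋) R := by
    filter_upwards [aux_small B γ x r hr] with R hR
    have : ∫ z in R, c ⌊z.re⌋ * g ⌊z.re⌋ z = ∫ z in R, c ⌊x.re⌋ * g ⌊x.re⌋ z := by
      refine integral_congr_ae ?_
      refine ae_mono (Measure.restrict_mono (hR.trans hb) le_rfl) ?_
      filter_upwards [ae_restrict_mem (aux_strip_meas _)] with z hz
      have hz' : ⌊z.re⌋ = ⌊x.re⌋ := hz
      rw [hz']
    unfold avgI
    rw [this, integral_const_mul]
    ring
  rw [tendsto_congr' h]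
  have hne := (hc ⌊x.re⌋).ne'
  constructor
  · intro h2
    have := h2.const_mul (c ⌊x.re⌋)⁻¹
    simpa [inv_mul_cancel_left₀ hne] using this
  · intro h2
    exact h2.const_mul _

/-- a nonempty at most countable union of `R⁺_{B,H}`-sets is a `W⁺_{B,H}`-set. -/
theorem countable_union_of_RPlusSets_is_WPlusSet (B H : DiffBasis)
    (hBH : ∀ x, B.sets x ⊆ H.sets x) (N : Set ℕ) (hN : N.Nonempty)
    (E : ℕ → Set Circle) (hE : ∀ k ∈ N, IsRPlusSet B H (E k)) :
    ∃ f : ℂ → ℝ, Integrable f ∧ (∀ z, 0 ≤ f z) ∧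
      (∀ γ ∈ ⋃ k ∈ N, E k, ¬ Differentiates (rotSets B.sets γ) f) ∧
      (∀ γ ∉ ⋃ k ∈ N, E k, Differentiates (rotSets H.sets γ) f) := by
  have hchoice : ∀ n : ℤ, ∃ k ∈ N, (n.toNat ∈ N → k = n.toNat) := by
    intro n
    by_cases h : n.toNat ∈ N
    · exact ⟨_, h, fun _ => rfl⟩
    · exact ⟨hN.some, hN.some_mem, fun h' => absurd h' h⟩
  choose e heN he using hchoice
  choose g hgi hg0 hgE hgH using fun n => hE (e n) (heN n)
  obtain ⟨w, hw0, _, hws, -⟩ := posSumOfEncodable (one_pos : (0:ℝ) < 1) ℤ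
  have hI : ∀ n, 0 ≤ ∫ z, g n z := fun n => integral_nonneg (hg0 n)
  let c : ℤ → ℝ := fun n => w n / (1 + ∫ z, g n z)
  have hc : ∀ n, 0 < c n := fun n => div_pos (hw0 n) (by linarith [hI n])
  have hc0 : ∀ n, c n * ∫ z, g n z ≤ w n := by
    intro n
    have h1 : 0 < 1 + ∫ z, g n z := by linarith [hI n]
    change w n / _ * _ ≤ _
    rw [div_mul_eq_mul_div, div_le_iff₀ h1]
    nlinarith [hw0 n]
  refine ⟨fun z => c ⌊z.re⌋ * g ⌊z.re⌋ z, ?_, fun z => mul_nonneg (hc _).le (hg0 _ _), ?_, ?_⟩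
  · have heq : ∀ n, EqOn (fun z : ℂ => c ⌊z.re⌋ * g ⌊z.re⌋ z) (fun z => c n * g n z) (strip n) := by
      intro n z hz
      have hz' : ⌊z.re⌋ = n := hz
      simp only [hz']
    have hU : (⋃ n, strip n) = univ := eq_univ_of_forall fun z => mem_iUnion.2 ⟨⌊z.re⌋, rfl⟩
    rw [← integrableOn_univ, ← hU]
    refine integrableOn_iUnion_of_summable_integral_norm
      (fun n => ((hgi n).const_mul (c n)).integrableOn.congr_fun (heq n).symm
        (aux_strip_meas n)) ?_
    refine Summable.of_nonneg_of_le (fun n => integral_nonneg fun z => norm_nonneg _) ?_ hws.summable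
    intro n
    refine le_trans ?_ (hc0 n)
    rw [← integral_const_mul]
    rw [setIntegral_congr_fun (aux_strip_meas n) (g := fun z => c n * g n z)]
    · exact setIntegral_le_integral ((hgi n).const_mul (c n))
        (Eventually.of_forall fun z => mul_nonneg (hc n).le (hg0 n z))
    · intro z hz
      have := heq n hz
      simp only at this ⊢
      rw [this, Real.norm_of_nonneg (mul_nonneg (hc n).le (hg0 n z))]
  · intro γ hγ hD
    simp only [mem_iUnion] at hγ
    obtain ⟨k, hk, hγ⟩ := hγ
    have hek : e (k : ℤ) = k := he (k : ℤ) (by simpa using hk)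
    have hae : ∀ᵐ x : ℂ, ⌊x.re⌋ ≠ (k : ℤ) := by
      filter_upwards [hD, aux_ae_good, hgE (k : ℤ) γ (by rw [hek]; exact hγ)] with x h1 h2 h3 h4
      rw [aux_tendsto, aux_local B γ x h2 c hc g, ← aux_tendsto, h4, h3] at h1
      exact EReal.coe_ne_top _ h1.1.symm
    have ho : IsOpen {z : ℂ | (k : ℝ) < z.re ∧ z.re < k + 1} :=
      (isOpen_lt continuous_const Complex.continuous_re).inter
        (isOpen_lt Complex.continuous_re continuous_const)
    obtain ⟨z, hz1, hz2⟩ := (Measure.dense_of_ae hae).inter_open_nonempty _ ho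
      ⟨((k : ℝ) + 1 / 2 : ℝ), by simp only [mem_setOf_eq, Complex.ofReal_re]; constructor <;> linarith⟩
    exact hz2 (Int.floor_eq_iff.2 ⟨by simpa using hz1.1.le, by simpa using hz1.2⟩)
  · intro γ hγ
    simp only [mem_iUnion, not_exists] at hγ
    have hall : ∀ᵐ x : ℂ, ∀ n : ℤ, upperD (rotSets H.sets γ) (g n) x = ((g n x : ℝ) : EReal) ∧
        lowerD (rotSets H.sets γ) (g n) x = ((g n x : ℝ) : EReal) :=
      ae_all_iff.2 fun n => hgH n γ (hγ _ (heN n))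
    filter_upwards [hall, aux_ae_good] with x h1 h2
    rw [aux_tendsto, aux_local H γ x h2 c hc g, ← aux_tendsto]
    exact h1 _

end
end
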